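/- Let n ≥ 2 be an integer, α > 0, p ∈ {1,…,n−1} coprime to n, and let g be a type (i) coupling satisfying the quantisation condition M ∈ ℤ ∖ {0}. Then for every r ∈ {1,…,n−1}, every ν ∈ S_n(ω_r), and every μ ∈ Λ⁺_{p,|M|} with μ+ν ∈ Λ⁺_{p,|M|}, the recurrence Δ_p(μ+ν) · V_ν(g; −ρ_p−sgn(M)(μ+ν)) = Δ_p(μ) · V_ν(g; ρ_p+sgn(M)μ) holds. -/

import Mathlib

noncomputable section
open Real Finset
open scoped Classical

/-- The standard basis vector `e_j` of `ℝⁿ` (1-based index), extended `n`-periodically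
(`e_{n+j} = e_j`). -/
def ee (n j : ℕ) : Fin n → ℝ := fun i => if ((i : ℕ) + 1) % n = j % n then 1 else 0

/-- The standard inner product on `ℝⁿ`. -/
def inn {n : ℕ} (x y : Fin n → ℝ) : ℝ := ∑ i, x i * y i

/-- The coordinate `x_j` (1-based index) with the convention `x_{n+k} = x_k - 2π/α`. -/
def coord {n : ℕ} (α : ℝ) (x : Fin n → ℝ) (j : ℕ) : ℝ :=
  if h : 0 < n then x ⟨(j - 1) % n, Nat.mod_lt _ h⟩ - 2 * π / α * (((j - 1) / n : ℕ) : ℝ)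
  else 0

/-- The simple roots `a_{j,p} = e_j - e_{j+p}`. -/
def aa (n p j : ℕ) : Fin n → ℝ := ee n j - ee n (j + p)

/-- The closed simplex `Σ̄_{g,p} = {x ∈ E_n : sgn(M)(x_j - x_{j+p} - g) ≥ 0, j = 1,…,n}`,
where `M = 2πp/α - ng`. -/
def SigmaBar (n p : ℕ) (α g : ℝ) : Set (Fin n → ℝ) :=
  {x | (∑ i, x i) = 0 ∧ ∀ j ∈ Icc 1 n,
    0 ≤ Real.sign (2 * π * p / α - n * g) * (coord α x j - coord α x (j + p) - g)}

/-- The interior `Σ_{g,p}` of the simplex, cut out by the strict inequalities. -/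
def SigmaInt (n p : ℕ) (α g : ℝ) : Set (Fin n → ℝ) :=
  {x | (∑ i, x i) = 0 ∧ ∀ j ∈ Icc 1 n,
    0 < Real.sign (2 * π * p / α - n * g) * (coord α x j - coord α x (j + p) - g)}

/-- `g` is a type (i) coupling, with `q ∈ {1,…,n-1}` the multiplicative inverse of `p` mod `n`. -/
def TypeI (n p q : ℕ) (α g : ℝ) : Prop :=
  1 ≤ q ∧ q ≤ n - 1 ∧ (p * q) % n = 1 % n ∧
  ((2 * π / α * ((p : ℝ) / n - 1 / ((n : ℝ) * q)) < g ∧ g < 2 * π / α * ((p : ℝ) / n)) ∨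
   (2 * π / α * ((p : ℝ) / n) < g ∧
      g < 2 * π / α * ((p : ℝ) / n + 1 / ((n : ℝ) * ((n : ℝ) - q)))))

/-- `ρ_p = g(ω_{1,p}+…+ω_{n-p,p}) + (g - 2π/α)(ω_{n-p+1,p}+…+ω_{n-1,p})`. -/
def rhoP (n p : ℕ) (α g : ℝ) (ω : ℕ → Fin n → ℝ) : Fin n → ℝ :=
  g • (∑ j ∈ Icc 1 (n - p), ω j) + (g - 2 * π / α) • (∑ j ∈ Icc (n - p + 1) (n - 1), ω j)

/-- `Λ⁺_{p,|M|}`: nonnegative integral combinations of the `ω_{j,p}` with coefficient sum `≤ |M|`. -/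
def Lam (n : ℕ) (Mabs : ℝ) (ω : ℕ → Fin n → ℝ) : Set (Fin n → ℝ) :=
  {μ | ∃ m : ℕ → ℕ, (∑ j ∈ Icc 1 (n - 1), (m j : ℝ)) ≤ Mabs ∧
    μ = ∑ j ∈ Icc 1 (n - 1), (m j : ℝ) • ω j}

/-- The fundamental weight `ω_r = e_1+…+e_r - (r/n)(e_1+…+e_n)`. -/
def omegaStd (n r : ℕ) : Fin n → ℝ :=
  fun i => (if (i : ℕ) + 1 ≤ r then 1 else 0) - (r : ℝ) / n

/-- Membership in the orbit `S_n(ω_r)` of `ω_r` under coordinate permutations. -/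
def inOrbit (n r : ℕ) (ν : Fin n → ℝ) : Prop :=
  ∃ σ : Equiv.Perm (Fin n), ν = fun i => omegaStd n r (σ i)

/-- The orbit `S_n(ω_r)` as a finite set. -/
def orbitF (n r : ℕ) : Finset (Fin n → ℝ) :=
  Finset.image (fun σ : Equiv.Perm (Fin n) => fun i => omegaStd n r (σ i)) Finset.univ

/-- `V_ν(g;x) = ∏_{a ∈ A_{n-1}, ⟨a,ν⟩=1} sin(α(⟨a,x⟩+g)/2)/sin(α⟨a,x⟩/2)`. -/
def Vnu (n : ℕ) (α g : ℝ) (ν x : Fin n → ℝ) : ℝ :=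
  ∏ j ∈ Icc 1 n, ∏ k ∈ Icc 1 n,
    if j ≠ k ∧ inn (ee n j - ee n k) ν = 1 then
      Real.sin (α * (inn (ee n j - ee n k) x + g) / 2) /
        Real.sin (α * inn (ee n j - ee n k) x / 2)
    else 1

/-- `V_J(g;x) = ∏_{j∈J, k∉J} sin(α(x_j-x_k+g)/2)/sin(α(x_j-x_k)/2)`. -/
def VJ (n : ℕ) (α g : ℝ) (J : Finset ℕ) (x : Fin n → ℝ) : ℝ :=
  ∏ j ∈ J, ∏ k ∈ Icc 1 n \ J,
    Real.sin (α * (coord α x j - coord α x k + g) / 2) /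
      Real.sin (α * (coord α x j - coord α x k) / 2)

/-- `F_J(g;x) = ∏_{j,k∈J, j≠k} sin(α(x_j-x_k)/2)/sin(α(x_j-x_k+g)/2)`. -/
def FJ (n : ℕ) (α g : ℝ) (J : Finset ℕ) (x : Fin n → ℝ) : ℝ :=
  ∏ j ∈ J, ∏ k ∈ J,
    if j ≠ k then
      Real.sin (α * (coord α x j - coord α x k) / 2) /
        Real.sin (α * (coord α x j - coord α x k + g) / 2)
    else 1

/-- The trigonometric Pochhammer symbol `(z : sin_α)_m`. -/
def poch (α z : ℝ) (m : ℤ) : ℝ :=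
  if 0 ≤ m then ∏ l ∈ Finset.range m.toNat, Real.sin (α * (z + l) / 2)
  else 1 / ∏ l ∈ Finset.Icc 1 (-m).toNat, Real.sin (α * (z - l) / 2)

/-- Membership in the set of positive roots `A⁺_{n-1,p}`. -/
def inPosRoots (n p : ℕ) (v : Fin n → ℝ) : Prop :=
  (∃ j ∈ Icc 1 n, ∃ k ∈ Icc 1 n, j ≠ k ∧ v = ee n j - ee n k) ∧
  ∃ c : ℕ → ℕ, v = ∑ j ∈ Icc 1 (n - 1), (c j : ℝ) • aa n p j

/-- The lattice function `Δ_p(μ)`. -/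
def Delta (n p : ℕ) (α g : ℝ) (ω : ℕ → Fin n → ℝ) (μ : Fin n → ℝ) : ℝ :=
  ∏ j ∈ Icc 1 n, ∏ k ∈ Icc 1 n,
    if inPosRoots n p (ee n j - ee n k) then
      Real.sin (α * inn (ee n j - ee n k)
          (rhoP n p α g ω + Real.sign (2 * π * p / α - n * g) • μ) / 2) /
        Real.sin (α * inn (ee n j - ee n k) (rhoP n p α g ω) / 2) *
      (poch α (inn (ee n j - ee n k) (rhoP n p α g ω) +
            Real.sign (2 * π * p / α - n * g) * g)
          ⌊Real.sign (2 * π * p / α - n * g) * inn (ee n j - ee n k) μ⌋ /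
        poch α (inn (ee n j - ee n k) (rhoP n p α g ω) + 1 -
            Real.sign (2 * π * p / α - n * g) * g)
          ⌊Real.sign (2 * π * p / α - n * g) * inn (ee n j - ee n k) μ⌋)
    else 1

/-- The coefficient `W_ν(ρ_p + sgn(M)μ)` (equal to `0` when `μ + ν ∉ Λ⁺_{p,|M|}`). -/
def Wmu (n p : ℕ) (α g : ℝ) (ω : ℕ → Fin n → ℝ) (s : (Fin n → ℝ) → ℝ)
    (μ ν : Fin n → ℝ) : ℝ :=
  if μ + ν ∈ Lam n |2 * π * p / α - n * g| ω then
    s ν * Real.sqrt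
      (Vnu n α g ν (rhoP n p α g ω + Real.sign (2 * π * p / α - n * g) • μ) *
       Vnu n α g ν (-(rhoP n p α g ω) - Real.sign (2 * π * p / α - n * g) • (μ + ν)))
  else 0

/-- The discrete difference operator `Ŝ_{r,M}` acting on lattice functions. -/
def SOp (n p r : ℕ) (α g : ℝ) (ω : ℕ → Fin n → ℝ) (s : (Fin n → ℝ) → ℝ)
    (φ : (Fin n → ℝ) → ℂ) : (Fin n → ℝ) → ℂ :=
  fun x => ∑ ν ∈ orbitF n r,
    (Wmu n p α g ω s (Real.sign (2 * π * p / α - n * g) • (x - rhoP n p α g ω)) ν : ℂ) *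
      φ (x + Real.sign (2 * π * p / α - n * g) • ν)

/-- The inner product `(φ, ψ)_{p,M}` on lattice functions. -/
def ip (n p : ℕ) (α g : ℝ) (ω : ℕ → Fin n → ℝ) (φ ψ : (Fin n → ℝ) → ℂ) : ℂ :=
  ∑ᶠ μ ∈ Lam n |2 * π * p / α - n * g| ω,
    φ (rhoP n p α g ω + Real.sign (2 * π * p / α - n * g) • μ) *
      starRingEnd ℂ (ψ (rhoP n p α g ω + Real.sign (2 * π * p / α - n * g) • μ))

/-- The elementary symmetric function `ℰ_r(u) = Σ_{ν ∈ S_n(ω_r)} exp(iα⟨ν,u⟩)`. -/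
def calE (n r : ℕ) (α : ℝ) (u : Fin n → ℝ) : ℂ :=
  ∑ ν ∈ orbitF n r, Complex.exp (Complex.I * (α : ℂ) * (inn ν u : ℂ))

lemma inn_eq_dotProduct {n : ℕ} (x y : Fin n → ℝ) : inn x y = x ⬝ᵥ y := rfl

lemma ee_congr {n i j : ℕ} (h : i % n = j % n) : ee n i = ee n j := by
  unfold ee
  rw [h]

lemma aa_mod (n p j : ℕ) : aa n p (j % n) = aa n p j := by
  unfold aa
  rw [ee_congr (Nat.mod_mod j n), ee_congr (Nat.mod_add_mod j n p)]

lemma exists_ee_eq_single {n : ℕ} (hn : 2 ≤ n) (j : ℕ) :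
    ∃ i : Fin n, ((i : ℕ) + 1) % n = j % n ∧ ee n j = Pi.single i 1 := by
  have key : ∃ i : ℕ, i < n ∧ (i + 1) % n = j % n := by
    have hj := Nat.mod_lt j (by omega : 0 < n)
    rcases Nat.eq_zero_or_pos (j % n) with h | h
    · exact ⟨n - 1, by omega, by rw [Nat.sub_add_cancel (by omega), Nat.mod_self, h]⟩
    · exact ⟨j % n - 1, by omega, by rw [Nat.sub_add_cancel h, Nat.mod_mod]⟩
  obtain ⟨i, hi, hij⟩ := key
  refine ⟨⟨i, hi⟩, hij, ?_⟩
  funext l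
  by_cases hl : l = ⟨i, hi⟩
  · subst hl
    simp [ee, hij]
  · rw [Pi.single_eq_of_ne hl]
    have : ((l : ℕ) + 1) % n ≠ j % n := by
      rw [← hij]
      intro h
      have h' : (l : ℕ) % n = i % n := Nat.ModEq.add_right_cancel' 1 h
      rw [Nat.mod_eq_of_lt l.2, Nat.mod_eq_of_lt hi] at h'
      exact hl (Fin.ext h')
    simp [ee, this]

lemma ee_injOn {n j k : ℕ} (hn : 2 ≤ n) (h : ee n j = ee n k) : j % n = k % n := by
  obtain ⟨i, hi, hij⟩ := exists_ee_eq_single hn j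
  have h1 : ee n k i = 1 := by rw [← h, hij]; simp
  by_contra hne
  rw [← hi] at hne
  simp [ee, hne] at h1

lemma eq_of_mem_Icc_of_mod_eq {n j k : ℕ} (hj : j ∈ Icc 1 n) (hk : k ∈ Icc 1 n)
    (h : j % n = k % n) : j = k := by
  rw [mem_Icc] at hj hk
  have h' : (j - 1) % n = (k - 1) % n := by
    apply Nat.ModEq.add_right_cancel' 1
    rw [Nat.sub_add_cancel hj.1, Nat.sub_add_cancel hk.1]
    exact h
  rw [Nat.mod_eq_of_lt (by omega), Nat.mod_eq_of_lt (by omega)] at h'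
  omega

lemma inn_root_orbit {n r : ℕ} (hn : 2 ≤ n) {ν : Fin n → ℝ} (hν : inOrbit n r ν) (j k : ℕ) :
    inn (ee n j - ee n k) ν = 1 ∨ inn (ee n j - ee n k) ν = 0 ∨
      inn (ee n j - ee n k) ν = -1 := by
  obtain ⟨σ, rfl⟩ := hν
  obtain ⟨i, -, hi⟩ := exists_ee_eq_single hn j
  obtain ⟨l, -, hl⟩ := exists_ee_eq_single hn k
  rw [hi, hl, inn_eq_dotProduct, sub_dotProduct, single_one_dotProduct, single_one_dotProduct]
  unfold omegaStd
  split_ifs <;> ring_nf <;> simp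

/-! ### Positive roots as strings of simple roots -/

lemma ee_sub_eq_sum_aa (n p : ℕ) {i j : ℕ} (h : i ≤ j) :
    ee n (i * p) - ee n (j * p) = ∑ t ∈ Ico i j, aa n p (t * p % n) := by
  rw [← neg_sub, ← Finset.sum_Ico_sub (fun t => ee n (t * p)) h, ← Finset.sum_neg_distrib]
  refine Finset.sum_congr rfl fun t _ => ?_
  rw [aa_mod, neg_sub, aa, add_one_mul]

lemma mul_mod_mem_Icc {n p t : ℕ} (hcop : Nat.Coprime p n) (h1 : 1 ≤ t) (h2 : t < n) :
    t * p % n ∈ Icc 1 (n - 1) := by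
  have h3 := Nat.mod_lt (t * p) (by omega : 0 < n)
  have h4 : t * p % n ≠ 0 := fun h => by
    have := Nat.le_of_dvd h1 (hcop.symm.dvd_of_dvd_mul_right (Nat.dvd_of_mod_eq_zero h))
    omega
  rw [mem_Icc]
  omega

lemma mul_mod_injOn {n p : ℕ} (hcop : Nat.Coprime p n) :
    Set.InjOn (fun t => t * p % n) (Set.Iio n) := by
  intro a ha b hb h
  have h' : a ≡ b [MOD n] := Nat.ModEq.cancel_right_of_coprime (by rwa [Nat.coprime_comm] at hcop) h
  unfold Nat.ModEq at h'
  rwa [Nat.mod_eq_of_lt ha, Nat.mod_eq_of_lt hb] at h'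

lemma exists_mul_mod_eq {n p q : ℕ} (hn : 2 ≤ n) (hpq : p * q % n = 1 % n) (j : ℕ) :
    ∃ i ∈ Icc 1 n, i * p % n = j % n := by
  have key : ∀ i, i % n = j * q % n → i * p % n = j % n := fun i hi => by
    have h1 : i * p ≡ j * q * p [MOD n] := Nat.ModEq.mul_right p hi
    have h2 : j * (p * q) ≡ j * 1 [MOD n] := Nat.ModEq.mul_left j hpq
    rw [mul_assoc, mul_comm q p] at h1
    rw [mul_one] at h2
    exact h1.trans h2
  rcases Nat.eq_zero_or_pos (j * q % n) with h | h
  · exact ⟨n, by rw [mem_Icc]; omega, key n (by rw [Nat.mod_self, h])⟩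
  · have := Nat.mod_lt (j * q) (by omega : 0 < n)
    exact ⟨j * q % n, by rw [mem_Icc]; omega, key _ (Nat.mod_mod _ _)⟩

lemma exists_root_string {n p q : ℕ} (hn : 2 ≤ n) (hpq : p * q % n = 1 % n) {j k : ℕ}
    (hj : j ∈ Icc 1 n) (hk : k ∈ Icc 1 n) (hjk : j ≠ k) :
    ∃ i l, 1 ≤ i ∧ i < l ∧ l ≤ n ∧
      (ee n j - ee n k = ∑ t ∈ Ico i l, aa n p (t * p % n) ∨
        ee n k - ee n j = ∑ t ∈ Ico i l, aa n p (t * p % n)) := by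
  obtain ⟨i, hi, hij⟩ := exists_mul_mod_eq hn hpq j
  obtain ⟨l, hl, hlk⟩ := exists_mul_mod_eq hn hpq k
  rw [mem_Icc] at hi hl
  rw [← ee_congr hij, ← ee_congr hlk]
  rcases lt_trichotomy i l with h | h | h
  · exact ⟨i, l, hi.1, h, hl.2, Or.inl (ee_sub_eq_sum_aa n p h.le)⟩
  · subst h
    exact absurd (eq_of_mem_Icc_of_mod_eq hj hk (hij.symm.trans hlk)) hjk
  · exact ⟨l, i, hl.1, h, hi.2, Or.inr (ee_sub_eq_sum_aa n p h.le)⟩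

lemma inPosRoots_of_root_string {n p : ℕ} (hcop : Nat.Coprime p n) {j k i l : ℕ}
    (hj : j ∈ Icc 1 n) (hk : k ∈ Icc 1 n) (hjk : j ≠ k) (hi : 1 ≤ i) (hl : l ≤ n)
    (h : ee n j - ee n k = ∑ t ∈ Ico i l, aa n p (t * p % n)) :
    inPosRoots n p (ee n j - ee n k) := by
  refine ⟨⟨j, hj, k, hk, hjk, rfl⟩, fun m => ∑ t ∈ Ico i l, if t * p % n = m then 1 else 0, ?_⟩
  rw [h]
  push_cast
  simp_rw [Finset.sum_smul]
  rw [Finset.sum_comm]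
  refine Finset.sum_congr rfl fun t ht => ?_
  rw [mem_Ico] at ht
  simp [ite_smul, mem_Icc.1 (mul_mod_mem_Icc hcop (hi.trans ht.1) (ht.2.trans_le hl))]

lemma not_inPosRoots_self {n p : ℕ} (hn : 2 ≤ n) (j : ℕ) :
    ¬ inPosRoots n p (ee n j - ee n j) := by
  rintro ⟨⟨a, ha, b, hb, hab, h⟩, -⟩
  rw [sub_self] at h
  exact hab (eq_of_mem_Icc_of_mod_eq ha hb (ee_injOn hn (sub_eq_zero.1 h.symm)))

lemma inn_aa_comb {n p : ℕ} {ω : ℕ → Fin n → ℝ}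
    (hωδ : ∀ j : ℕ, 1 ≤ j → j ≤ n - 1 → ∀ k : ℕ, 1 ≤ k → k ≤ n - 1 →
      inn (aa n p j) (ω k) = if j = k then (1 : ℝ) else 0)
    (c : ℕ → ℝ) {s : Finset ℕ} (hs : s ⊆ Icc 1 (n - 1)) {j : ℕ} (hj : j ∈ Icc 1 (n - 1)) :
    inn (aa n p j) (∑ k ∈ s, c k • ω k) = if j ∈ s then c j else 0 := by
  rw [inn_eq_dotProduct, dotProduct_sum]
  rw [mem_Icc] at hj
  rw [← Finset.sum_ite_eq s j c]
  refine Finset.sum_congr rfl fun k hk => ?_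
  have hk' := mem_Icc.1 (hs hk)
  rw [dotProduct_smul, ← inn_eq_dotProduct, hωδ j hj.1 hj.2 k hk'.1 hk'.2]
  simp

lemma inPosRoots_asymm {n p : ℕ} {ω : ℕ → Fin n → ℝ} (hn : 2 ≤ n)
    (hωδ : ∀ j : ℕ, 1 ≤ j → j ≤ n - 1 → ∀ k : ℕ, 1 ≤ k → k ≤ n - 1 →
      inn (aa n p j) (ω k) = if j = k then (1 : ℝ) else 0) {j k : ℕ}
    (h : inPosRoots n p (ee n j - ee n k)) : ¬ inPosRoots n p (ee n k - ee n j) := by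
  rintro ⟨-, d, hd⟩
  obtain ⟨hroot, c, hc⟩ := id h
  have coeff : ∀ f : ℕ → ℕ, ∀ i ∈ Icc 1 (n - 1),
      inn (∑ m ∈ Icc 1 (n - 1), (f m : ℝ) • aa n p m) (ω i) = f i := fun f i hi => by
    rw [inn_eq_dotProduct, sum_dotProduct]
    rw [mem_Icc] at hi
    rw [Finset.sum_eq_single i]
    · rw [smul_dotProduct, ← inn_eq_dotProduct, hωδ i hi.1 hi.2 i hi.1 hi.2]; simp
    · intro b hb hbi
      rw [mem_Icc] at hb
      rw [smul_dotProduct, ← inn_eq_dotProduct, hωδ b hb.1 hb.2 i hi.1 hi.2]; simp [hbi]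
    · intro h; exact absurd (mem_Icc.2 hi) h
  have hzero : ∀ i ∈ Icc 1 (n - 1), c i = 0 := fun i hi => by
    have h1 : (c i : ℝ) + d i = 0 := by
      rw [← coeff c i hi, ← coeff d i hi, ← hc, ← hd, inn_eq_dotProduct, inn_eq_dotProduct,
        ← add_dotProduct]
      simp
    have h2 : c i + d i = 0 := by exact_mod_cast h1
    omega
  have h0 : ee n j - ee n k = ee n j - ee n j := by
    rw [hc, sub_self]
    exact Finset.sum_eq_zero fun i hi => by rw [hzero i hi]; simp
  rw [h0] at h
  exact not_inPosRoots_self hn j h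

lemma inPosRoots.exists_root_string {n p q : ℕ} {ω : ℕ → Fin n → ℝ} (hn : 2 ≤ n)
    (hcop : Nat.Coprime p n) (hpq : p * q % n = 1 % n)
    (hωδ : ∀ j : ℕ, 1 ≤ j → j ≤ n - 1 → ∀ k : ℕ, 1 ≤ k → k ≤ n - 1 →
      inn (aa n p j) (ω k) = if j = k then (1 : ℝ) else 0) {j k : ℕ}
    (hj : j ∈ Icc 1 n) (hk : k ∈ Icc 1 n) (h : inPosRoots n p (ee n j - ee n k)) :
    ∃ i l, 1 ≤ i ∧ i < l ∧ l ≤ n ∧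
      ee n j - ee n k = ∑ t ∈ Ico i l, aa n p (t * p % n) := by
  have hjk : j ≠ k := by
    rintro rfl
    exact not_inPosRoots_self hn j h
  obtain ⟨i, l, hi, hil, hl, h' | h'⟩ := _root_.exists_root_string hn hpq hj hk hjk
  · exact ⟨i, l, hi, hil, hl, h'⟩
  · exact absurd (inPosRoots_of_root_string hcop hk hj hjk.symm hi hl h')
      (inPosRoots_asymm hn hωδ h)

lemma inPosRoots_total {n p q : ℕ} (hn : 2 ≤ n)
    (hcop : Nat.Coprime p n) (hpq : p * q % n = 1 % n) {j k : ℕ}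
    (hj : j ∈ Icc 1 n) (hk : k ∈ Icc 1 n) (hjk : j ≠ k) :
    inPosRoots n p (ee n j - ee n k) ∨ inPosRoots n p (ee n k - ee n j) := by
  obtain ⟨i, l, hi, -, hl, h' | h'⟩ := exists_root_string hn hpq hj hk hjk
  · exact Or.inl (inPosRoots_of_root_string hcop hj hk hjk hi hl h')
  · exact Or.inr (inPosRoots_of_root_string hcop hk hj hjk.symm hi hl h')

/-- A root string pairs with `ρ_p` to its height times `g`, up to a multiple of `2π/α`. -/
lemma inn_root_string_rhoP {n p : ℕ} (α g : ℝ) {ω : ℕ → Fin n → ℝ}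
    (hp1 : 1 ≤ p) (hcop : Nat.Coprime p n)
    (hωδ : ∀ j : ℕ, 1 ≤ j → j ≤ n - 1 → ∀ k : ℕ, 1 ≤ k → k ≤ n - 1 →
      inn (aa n p j) (ω k) = if j = k then (1 : ℝ) else 0) {i l : ℕ}
    (hi : 1 ≤ i) (hil : i < l) (hl : l ≤ n) :
    ∃ K : ℕ, inn (∑ t ∈ Ico i l, aa n p (t * p % n)) (rhoP n p α g ω) =
      ((l - i : ℕ) : ℝ) * g - 2 * π / α * K := by
  refine ⟨∑ t ∈ Ico i l, if t * p % n ≤ n - p then 0 else 1, ?_⟩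
  have hterm : ∀ t ∈ Ico i l, inn (aa n p (t * p % n)) (rhoP n p α g ω) =
      g - 2 * π / α * (if t * p % n ≤ n - p then 0 else 1 : ℕ) := fun t ht => by
    rw [mem_Ico] at ht
    have hm := mul_mod_mem_Icc hcop (hi.trans ht.1) (ht.2.trans_le hl)
    have h1 := inn_aa_comb hωδ (fun _ => g) (s := Icc 1 (n - p))
      (Icc_subset_Icc le_rfl (by omega)) hm
    have h2 := inn_aa_comb hωδ (fun _ => g - 2 * π / α) (s := Icc (n - p + 1) (n - 1))
      (Icc_subset_Icc (by omega) le_rfl) hm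
    rw [mem_Icc] at hm
    rw [rhoP, Finset.smul_sum, Finset.smul_sum, inn_eq_dotProduct, dotProduct_add,
      ← inn_eq_dotProduct, ← inn_eq_dotProduct, h1, h2]
    by_cases h : t * p % n ≤ n - p
    · have : ¬ (n - p + 1 ≤ t * p % n) := by omega
      simp [h, hm.1, this]
    · have : n - p + 1 ≤ t * p % n := by omega
      simp [h, hm.2, this]
  have hsum := Finset.sum_congr rfl hterm
  rw [inn_eq_dotProduct, sum_dotProduct]
  simp_rw [← inn_eq_dotProduct]
  rw [hsum, Finset.sum_sub_distrib, ← Finset.mul_sum, Finset.sum_const, Nat.card_Ico, nsmul_eq_mul]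
  push_cast
  rfl

lemma inn_root_string_Lam {n p : ℕ} {ω : ℕ → Fin n → ℝ} (hcop : Nat.Coprime p n)
    (hωδ : ∀ j : ℕ, 1 ≤ j → j ≤ n - 1 → ∀ k : ℕ, 1 ≤ k → k ≤ n - 1 →
      inn (aa n p j) (ω k) = if j = k then (1 : ℝ) else 0) {i l : ℕ}
    (hi : 1 ≤ i) (hl : l ≤ n) {N : ℝ} {μ : Fin n → ℝ} (hμ : μ ∈ Lam n N ω) :
    ∃ m : ℕ, inn (∑ t ∈ Ico i l, aa n p (t * p % n)) μ = m ∧ (m : ℝ) ≤ N := by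
  obtain ⟨c, hc, rfl⟩ := hμ
  have hmem : ∀ t ∈ Ico i l, t * p % n ∈ Icc 1 (n - 1) := fun t ht => by
    rw [mem_Ico] at ht
    exact mul_mod_mem_Icc hcop (hi.trans ht.1) (ht.2.trans_le hl)
  refine ⟨∑ t ∈ Ico i l, c (t * p % n), ?_, le_trans ?_ hc⟩
  · rw [inn_eq_dotProduct, sum_dotProduct, Nat.cast_sum]
    refine Finset.sum_congr rfl fun t ht => ?_
    rw [← inn_eq_dotProduct, inn_aa_comb hωδ (fun k => (c k : ℝ)) subset_rfl (hmem t ht),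
      if_pos (hmem t ht)]
  · have hinj : Set.InjOn (fun t => t * p % n) (Ico i l : Finset ℕ) :=
      (mul_mod_injOn hcop).mono fun t ht => by
        rw [mem_coe, mem_Ico] at ht
        exact ht.2.trans_le hl
    rw [← Finset.sum_image (f := c) hinj, ← Nat.cast_sum, Nat.cast_le]
    exact Finset.sum_le_sum_of_subset (Finset.image_subset_iff.2 hmem)

/-! ### Nonvanishing of the sine factors -/

lemma sin_ne_zero_of_mem_Ioo {x : ℝ} (L : ℤ) (h1 : L * π < x) (h2 : x < (L + 1) * π) :
    Real.sin x ≠ 0 := by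
  rw [Ne, Real.sin_eq_zero_iff]
  rintro ⟨N, rfl⟩
  have h3 : (L : ℝ) < N := lt_of_mul_lt_mul_right h1 pi_pos.le
  have h4 : (N : ℝ) < L + 1 := lt_of_mul_lt_mul_right h2 pi_pos.le
  have h5 : L < N := by exact_mod_cast h3
  have h6 : N < L + 1 := by exact_mod_cast h4
  omega

lemma le_of_dvd_sub {n a k : ℤ} (h : n ∣ a - k) (ha : 0 ≤ a) (hk : k < n) : k ≤ a := by
  by_contra! hlt
  have := Int.le_of_dvd (by omega : 0 < k - a) ((dvd_sub_comm).1 h)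
  omega

/-- If `b * l ≡ k` modulo `n` and the slope `x` satisfies `x * b < 2π`, then the segment
`[2πl - xk, 2πl + x(n-k)]` lies strictly inside `(0, 2πn)`. -/
lemma segment_bounds {n b k l : ℤ} {x : ℝ} (hx : 0 < x) (hb : 1 ≤ b) (hxb : x * b < 2 * π)
    (hk1 : 1 ≤ k) (hkn : k < n) (hl1 : 1 ≤ l) (hln : l < n) (hdvd : n ∣ b * l - k) :
    x * k < 2 * π * l ∧ x * (n - k) < 2 * π * (n - l) := by
  have h1 : k ≤ b * l := le_of_dvd_sub hdvd (by nlinarith) hkn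
  have h2 : n - k ≤ b * (n - l) := by
    refine le_of_dvd_sub (n := n) ?_ (by nlinarith) (by omega)
    have : b * (n - l) - (n - k) = n * (b - 1) - (b * l - k) := by ring
    rw [this]
    exact dvd_sub (dvd_mul_right _ _) hdvd
  have h1' : (k : ℝ) ≤ b * l := by exact_mod_cast h1
  have h2' : (n : ℝ) - k ≤ b * (n - l) := by exact_mod_cast h2
  have hl1' : (0 : ℝ) < l := by exact_mod_cast hl1
  have hln' : (0 : ℝ) < (n : ℝ) - l := by
    have : (l : ℝ) < n := by exact_mod_cast hln
    linarith
  constructor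
  · calc x * k ≤ x * (b * l) := by gcongr
      _ = x * b * l := by ring
      _ < 2 * π * l := by gcongr
  · calc x * (n - k) ≤ x * (b * (n - l)) := by gcongr
      _ = x * b * (n - l) := by ring
      _ < 2 * π * (n - l) := by gcongr

lemma TypeI.pos_or_neg {n p q : ℕ} {α g M : ℝ} (hn : 2 ≤ n) (hα : 0 < α)
    (htype : TypeI n p q α g) (hM : 2 * π * p / α - n * g = M) :
    (0 < M ∧ α * M * q < 2 * π) ∨ (M < 0 ∧ α * (-M) * (n - q : ℝ) < 2 * π) := by
  obtain ⟨hq1, hqn, -, h⟩ := htype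
  have hn0 : (0 : ℝ) < n := by positivity
  have hq0 : (0 : ℝ) < q := by positivity
  have hnq : (0 : ℝ) < (n : ℝ) - q := by
    have : (q : ℝ) < n := by exact_mod_cast (by omega : q < n)
    linarith
  subst hM
  refine h.imp (fun h => ?_) fun h => ?_
  · have e1 : 2 * π * p / α - n * g = n * (2 * π / α * ((p : ℝ) / n) - g) := by
      field_simp
    have e2 : 2 * π - α * (2 * π * p / α - n * g) * q =
        α * n * q * (g - 2 * π / α * ((p : ℝ) / n - 1 / ((n : ℝ) * q))) := by
      field_simp
      ring
    refine ⟨e1 ▸ mul_pos hn0 (sub_pos.2 h.2), sub_pos.1 ?_⟩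
    rw [e2]
    exact mul_pos (by positivity) (sub_pos.2 h.1)
  · have e1 : 2 * π * p / α - n * g = -(n * (g - 2 * π / α * ((p : ℝ) / n))) := by
      field_simp
      ring
    have e2 : 2 * π - α * (-(2 * π * p / α - n * g)) * (n - q) =
        α * n * (n - q) *
          (2 * π / α * ((p : ℝ) / n + 1 / ((n : ℝ) * ((n : ℝ) - q))) - g) := by
      field_simp
      ring
    refine ⟨e1 ▸ neg_neg_of_pos (mul_pos hn0 (sub_pos.2 h.1)), sub_pos.1 ?_⟩
    rw [e2]
    exact mul_pos (by positivity) (sub_pos.2 h.2)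

lemma sin_shift_ne_zero {α : ℝ} (hα : 0 < α) (x : ℝ) (K : ℕ) (h : Real.sin (α * x / 2) ≠ 0) :
    Real.sin (α * (x - 2 * π / α * K) / 2) ≠ 0 := by
  have e : α * (x - 2 * π / α * K) / 2 = α * x / 2 - K * π := by
    field_simp
  rw [e, Real.sin_sub_nat_mul_pi]
  exact mul_ne_zero (pow_ne_zero _ (by norm_num)) h

lemma TypeI.sin_height_ne_zero {n p q : ℕ} {α g M : ℝ} (hn : 2 ≤ n) (hα : 0 < α)
    (hcop : Nat.Coprime p n) (htype : TypeI n p q α g) (hM : 2 * π * p / α - n * g = M)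
    {k : ℕ} (hk1 : 1 ≤ k) (hkn : k < n) {m : ℝ} (hm0 : 0 ≤ m) (hm : m ≤ |M|) :
    Real.sin (α * (k * g + Real.sign M * m) / 2) ≠ 0 := by
  have hn0 : (0 : ℝ) < n := by positivity
  have hl := mem_Icc.1 (mul_mod_mem_Icc hcop hk1 hkn)
  have hdiv := Nat.div_add_mod (k * p) n
  set l := k * p % n
  set u := k * p / n
  obtain ⟨hq1, hqn, hpq, -⟩ := id htype
  have hdvd : (n : ℤ) ∣ q * l - k := by
    have h1 : (n : ℤ) ∣ p * q - 1 := by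
      have := (Nat.modEq_iff_dvd.1 (show 1 ≡ p * q [MOD n] from hpq.symm))
      exact_mod_cast this
    obtain ⟨c, hc⟩ := h1
    refine ⟨k * c - q * u, ?_⟩
    have h2 : (n : ℤ) * u + l = k * p := by exact_mod_cast hdiv
    linear_combination (q : ℤ) * h2 + k * hc
  have hang : α * n * g = 2 * π * p - α * M := by
    rw [← hM]
    field_simp
    ring
  have hdiv' : (n : ℝ) * u + l = k * p := by exact_mod_cast hdiv
  have hln : l < n := by omega
  rcases htype.pos_or_neg hn hα hM with ⟨hpos, hlt⟩ | ⟨hneg, hlt⟩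
  · rw [Real.sign_of_pos hpos]
    rw [abs_of_pos hpos] at hm
    have hb := segment_bounds (n := n) (b := q) (k := k) (l := l) (x := α * M)
      (by positivity) (by exact_mod_cast hq1) (by exact_mod_cast hlt) (by exact_mod_cast hk1)
      (by exact_mod_cast hkn) (by exact_mod_cast hl.1) (by exact_mod_cast hln) hdvd
    push_cast at hb
    have e : 2 * n * (α * (k * g + 1 * m) / 2) =
        2 * n * (u * π) + (2 * π * l - α * M * k + α * n * m) := by
      linear_combination (k : ℝ) * hang - 2 * π * hdiv'
    have h1 : 0 ≤ α * n * m := by positivity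
    have h2 : α * n * m ≤ α * n * M := by gcongr
    refine sin_ne_zero_of_mem_Ioo u ?_ ?_ <;> push_cast
    · refine lt_of_mul_lt_mul_left (a := 2 * (n : ℝ)) ?_ (by positivity)
      rw [e]; nlinarith [hb.1]
    · refine lt_of_mul_lt_mul_left (a := 2 * (n : ℝ)) ?_ (by positivity)
      rw [e]; nlinarith [hb.2]
  · rw [Real.sign_of_neg hneg]
    rw [abs_of_neg hneg] at hm
    have hdvd' : (n : ℤ) ∣ (n - q) * (n - l) - k := by
      have : ((n : ℤ) - q) * (n - l) - k = n * (n - l - q) + (q * l - k) := by ring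
      rw [this]
      exact dvd_add (dvd_mul_right _ _) hdvd
    have hb := segment_bounds (n := n) (b := n - q) (k := k) (l := n - l) (x := α * (-M))
      (mul_pos hα (by linarith)) (by omega) (by push_cast; exact hlt) (by exact_mod_cast hk1)
      (by exact_mod_cast hkn) (by omega) (by omega) hdvd'
    push_cast at hb
    have e : 2 * n * (α * (k * g + -1 * m) / 2) =
        2 * n * (u * π) + (2 * π * l - α * M * k - α * n * m) := by
      linear_combination (k : ℝ) * hang - 2 * π * hdiv'
    have h1 : 0 ≤ α * n * m := by positivity
    have h2 : α * n * m ≤ α * n * -M := by gcongr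
    refine sin_ne_zero_of_mem_Ioo u ?_ ?_ <;> push_cast
    · refine lt_of_mul_lt_mul_left (a := 2 * (n : ℝ)) ?_ (by positivity)
      rw [e]; nlinarith [hb.2]
    · refine lt_of_mul_lt_mul_left (a := 2 * (n : ℝ)) ?_ (by positivity)
      rw [e]; nlinarith [hb.1]

lemma TypeI.sin_sign_mul_ne_zero {n p q : ℕ} {α g M : ℝ} (hn : 2 ≤ n) (hα : 0 < α)
    (htype : TypeI n p q α g) (hM : 2 * π * p / α - n * g = M)
    {m : ℝ} (hm0 : 0 < m) (hm : m ≤ |M|) : Real.sin (α * (Real.sign M * m) / 2) ≠ 0 := by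
  have hpos : Real.sin (α * m / 2) ≠ 0 := by
    have hlt : α * |M| < 2 * π := by
      obtain ⟨hq1, hqn, -, -⟩ := id htype
      have hq1' : (1 : ℝ) ≤ q := by exact_mod_cast hq1
      have hnq : (1 : ℝ) ≤ (n : ℝ) - q := by
        have : (q : ℝ) + 1 ≤ n := by exact_mod_cast (by omega : q + 1 ≤ n)
        linarith
      rcases htype.pos_or_neg hn hα hM with ⟨h, h'⟩ | ⟨h, h'⟩
      · rw [abs_of_pos h]
        exact (le_mul_of_one_le_right (by positivity) hq1').trans_lt h'
      · rw [abs_of_neg h]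
        exact (le_mul_of_one_le_right (mul_pos hα (by linarith)).le hnq).trans_lt h'
    have h2 : α * m ≤ α * |M| := by gcongr
    exact (Real.sin_pos_of_pos_of_lt_pi (by positivity) (by linarith)).ne'
  rcases htype.pos_or_neg hn hα hM with ⟨h, -⟩ | ⟨h, -⟩
  · rwa [Real.sign_of_pos h, one_mul]
  · rw [Real.sign_of_neg h, show α * (-1 * m) / 2 = -(α * m / 2) by ring, Real.sin_neg]
    exact neg_ne_zero.2 hpos

/-! ### The recurrence for a single root -/

lemma poch_natCast (α z : ℝ) (m : ℕ) :
    poch α z m = ∏ l ∈ range m, Real.sin (α * (z + l) / 2) := by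
  simp [poch]

lemma poch_neg_natCast (α z : ℝ) (m : ℕ) :
    poch α z (-(m : ℤ)) = 1 / ∏ l ∈ Icc 1 m, Real.sin (α * (z - l) / 2) := by
  rcases Nat.eq_zero_or_pos m with rfl | h
  · simp [poch]
  · have : ¬ (0 : ℤ) ≤ -(m : ℤ) := by omega
    simp [poch, h.ne']

/-- The contribution to `Δ_p` of a root pairing to `z` with `ρ_p` and to `m` with the weight,
where `s` is the sign of `M`. -/
def rootFactor (α g s z m : ℝ) : ℝ :=
  Real.sin (α * (z + s * m) / 2) / Real.sin (α * z / 2) *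
    (poch α (z + s * g) ⌊s * m⌋ / poch α (z + 1 - s * g) ⌊s * m⌋)

lemma rootFactor_succ {α g s z : ℝ} (hs : s = 1 ∨ s = -1) (m : ℕ)
    (h0 : Real.sin (α * (z + s * m) / 2) ≠ 0)
    (h1 : Real.sin (α * (z + s * (m + 1)) / 2) ≠ 0)
    (h2 : Real.sin (α * (z + s * (m + 1) - g) / 2) ≠ 0) :
    rootFactor α g s z (m + 1) *
        (Real.sin (α * (-(z + s * (m + 1)) + g) / 2) / Real.sin (α * -(z + s * (m + 1)) / 2)) =
      rootFactor α g s z m *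
        (Real.sin (α * (z + s * m + g) / 2) / Real.sin (α * (z + s * m) / 2)) := by
  rw [show α * (-(z + s * (m + 1)) + g) / 2 = -(α * (z + s * (m + 1) - g) / 2) by ring,
    show α * -(z + s * (m + 1)) / 2 = -(α * (z + s * (m + 1)) / 2) by ring,
    Real.sin_neg, Real.sin_neg, neg_div_neg_eq]
  suffices hP : poch α (z + s * g) ⌊s * (m + 1)⌋ / poch α (z + 1 - s * g) ⌊s * (m + 1)⌋ *
      Real.sin (α * (z + s * (m + 1) - g) / 2) =
      poch α (z + s * g) ⌊s * m⌋ / poch α (z + 1 - s * g) ⌊s * m⌋ *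
        Real.sin (α * (z + s * m + g) / 2) by
    unfold rootFactor
    generalize poch α (z + s * g) ⌊s * (m + 1)⌋ / poch α (z + 1 - s * g) ⌊s * (m + 1)⌋ = P at *
    generalize poch α (z + s * g) ⌊s * m⌋ / poch α (z + 1 - s * g) ⌊s * m⌋ = Q at *
    calc _ = (Real.sin (α * z / 2))⁻¹ * (P * Real.sin (α * (z + s * (m + 1) - g) / 2)) *
          (Real.sin (α * (z + s * (m + 1)) / 2) / Real.sin (α * (z + s * (m + 1)) / 2)) := by ring
      _ = (Real.sin (α * z / 2))⁻¹ * (Q * Real.sin (α * (z + s * m + g) / 2)) *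
          (Real.sin (α * (z + s * m) / 2) / Real.sin (α * (z + s * m) / 2)) := by
        rw [hP, div_self h0, div_self h1]
      _ = _ := by ring
  rcases hs with rfl | rfl
  · have f1 : ⌊(1 : ℝ) * (m + 1)⌋ = ((m + 1 : ℕ) : ℤ) := by
      rw [one_mul]; exact_mod_cast Int.floor_natCast (R := ℝ) (m + 1)
    have f0 : ⌊(1 : ℝ) * m⌋ = (m : ℤ) := by simp
    rw [f1, f0]
    simp only [poch_natCast, prod_range_succ]
    rw [show z + 1 - 1 * g + m = z + 1 * (m + 1) - g by ring,
      show z + 1 * g + m = z + 1 * m + g by ring, mul_div_mul_comm, mul_assoc,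
      div_mul_cancel₀ _ h2]
  · have f1 : ⌊(-1 : ℝ) * (m + 1)⌋ = -((m + 1 : ℕ) : ℤ) := by
      rw [← Int.floor_intCast (R := ℝ) (-((m + 1 : ℕ) : ℤ))]; push_cast; congr 1; ring
    have f0 : ⌊(-1 : ℝ) * m⌋ = -(m : ℤ) := by
      rw [← Int.floor_intCast (R := ℝ) (-(m : ℤ))]; push_cast; congr 1; ring
    rw [f1, f0]
    simp only [poch_neg_natCast, prod_Icc_succ_top (Nat.le_add_left 1 m)]
    push_cast
    rw [div_div_div_cancel_left' _ _ one_ne_zero, div_div_div_cancel_left' _ _ one_ne_zero,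
      show z + 1 - -1 * g - (m + 1) = z + -1 * m + g by ring,
      show z + -1 * g - (m + 1) = z + -1 * (m + 1) - g by ring, mul_div_mul_comm, mul_assoc,
      div_mul_cancel₀ _ h2]

/-! ### Reduction to positive roots -/

lemma prod_prod_eq_prod_prod_ite {ι : Type*} {s : Finset ι} {P : ι → ι → Prop} {F : ι → ι → ℝ}
    (hF : ∀ j ∈ s, F j j = 1) (hirr : ∀ j ∈ s, ¬ P j j)
    (htot : ∀ j ∈ s, ∀ k ∈ s, j ≠ k → P j k ∨ P k j)
    (hasymm : ∀ j ∈ s, ∀ k ∈ s, P j k → ¬ P k j) :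
    ∏ j ∈ s, ∏ k ∈ s, F j k = ∏ j ∈ s, ∏ k ∈ s, if P j k then F j k * F k j else 1 := by
  calc ∏ j ∈ s, ∏ k ∈ s, F j k
      = ∏ j ∈ s, ∏ k ∈ s, (if P j k then F j k else 1) * (if P k j then F j k else 1) := by
        refine prod_congr rfl fun j hj => prod_congr rfl fun k hk => ?_
        by_cases hjk : j = k
        · subst hjk
          simp [hirr j hj, hF j hj]
        · rcases htot j hj k hk hjk with h | h
          · simp [h, hasymm j hj k hk h]
          · simp [h, hasymm k hk j hj h]
    _ = (∏ j ∈ s, ∏ k ∈ s, if P j k then F j k else 1) *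
          ∏ j ∈ s, ∏ k ∈ s, if P k j then F j k else 1 := by
        simp only [prod_mul_distrib]
    _ = (∏ j ∈ s, ∏ k ∈ s, if P j k then F j k else 1) *
          ∏ j ∈ s, ∏ k ∈ s, if P j k then F k j else 1 := by
        congr 1
        exact prod_comm
    _ = _ := by
        simp only [← prod_mul_distrib]
        refine prod_congr rfl fun j hj => prod_congr rfl fun k hk => ?_
        split_ifs <;> simp

/-- Lemma 3.1: the recurrence
`Δ_p(μ+ν)·V_ν(g;-ρ_p-sgn(M)(μ+ν)) = Δ_p(μ)·V_ν(g;ρ_p+sgn(M)μ)`. -/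
theorem statement13 (n p q : ℕ) (α g : ℝ)
    (hn : 2 ≤ n) (hα : 0 < α) (hp1 : 1 ≤ p) (hpn : p ≤ n - 1) (hcop : Nat.Coprime p n)
    (htype : TypeI n p q α g)
    (Mz : ℤ) (hMz : 2 * π * p / α - n * g = (Mz : ℝ)) (hMz0 : Mz ≠ 0)
    (ω : ℕ → Fin n → ℝ)
    (hωE : ∀ k : ℕ, 1 ≤ k → k ≤ n - 1 → ∑ i, ω k i = 0)
    (hωδ : ∀ j : ℕ, 1 ≤ j → j ≤ n - 1 → ∀ k : ℕ, 1 ≤ k → k ≤ n - 1 →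
      inn (aa n p j) (ω k) = if j = k then (1 : ℝ) else 0)
    (r : ℕ) (hr1 : 1 ≤ r) (hrn : r ≤ n - 1)
    (ν : Fin n → ℝ) (hν : inOrbit n r ν)
    (μ : Fin n → ℝ) (hμ : μ ∈ Lam n |2 * π * p / α - n * g| ω)
    (hμν : μ + ν ∈ Lam n |2 * π * p / α - n * g| ω) :
    Delta n p α g ω (μ + ν) *
        Vnu n α g ν
          (-(rhoP n p α g ω) - Real.sign (2 * π * p / α - n * g) • (μ + ν)) =
      Delta n p α g ω μ *
        Vnu n α g ν (rhoP n p α g ω + Real.sign (2 * π * p / α - n * g) • μ) := by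
  obtain ⟨-, -, hpq, -⟩ := id htype
  have hs : Real.sign (2 * π * p / α - n * g) = 1 ∨
      Real.sign (2 * π * p / α - n * g) = -1 := by
    rcases htype.pos_or_neg hn hα rfl with ⟨h, -⟩ | ⟨h, -⟩
    · exact Or.inl (Real.sign_of_pos h)
    · exact Or.inr (Real.sign_of_neg h)
  have hV : ∀ x : Fin n → ℝ, Vnu n α g ν x = _ := fun x =>
    prod_prod_eq_prod_prod_ite (s := Icc 1 n)
      (P := fun j k => inPosRoots n p (ee n j - ee n k)) (by simp)
      (fun j _ => not_inPosRoots_self hn j)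
      (fun j hj k hk => inPosRoots_total hn hcop hpq hj hk)
      (fun j _ k _ => inPosRoots_asymm hn hωδ)
  rw [hV, hV]
  unfold Delta
  simp only [← prod_mul_distrib]
  refine prod_congr rfl fun j hj => prod_congr rfl fun k hk => ?_
  by_cases hpos : inPosRoots n p (ee n j - ee n k)
  swap
  · simp [hpos]
  have hjk : j ≠ k := by
    rintro rfl
    exact not_inPosRoots_self hn j hpos
  obtain ⟨i, l, hi, hil, hl, hstr⟩ := hpos.exists_root_string hn hcop hpq hωδ hj hk
  obtain ⟨K, hK⟩ := inn_root_string_rhoP α g hp1 hcop hωδ hi hil hl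
  obtain ⟨m, hm, hmM⟩ := inn_root_string_Lam hcop hωδ hi hl hμ
  obtain ⟨m', hm', hmM'⟩ := inn_root_string_Lam hcop hωδ hi hl hμν
  rw [← hstr] at hK hm hm'
  have hνm : inn (ee n j - ee n k) ν = m' - m := by
    rw [← hm, ← hm', inn_eq_dotProduct, inn_eq_dotProduct, inn_eq_dotProduct, dotProduct_add]
    ring
  have hneg : ∀ x : Fin n → ℝ, inn (ee n k - ee n j) x = -inn (ee n j - ee n k) x := fun x => by
    rw [← neg_sub, inn_eq_dotProduct, neg_dotProduct, ← inn_eq_dotProduct]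
  have hx : ∀ y : Fin n → ℝ, inn (ee n j - ee n k)
      (rhoP n p α g ω + Real.sign (2 * π * p / α - n * g) • y) =
      inn (ee n j - ee n k) (rhoP n p α g ω) +
        Real.sign (2 * π * p / α - n * g) * inn (ee n j - ee n k) y := fun y => by
    simp only [inn_eq_dotProduct, dotProduct_add, dotProduct_smul, smul_eq_mul]
  have hx' : inn (ee n j - ee n k)
      (-(rhoP n p α g ω) - Real.sign (2 * π * p / α - n * g) • (μ + ν)) =
      -(inn (ee n j - ee n k) (rhoP n p α g ω) +
        Real.sign (2 * π * p / α - n * g) * m') := by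
    rw [← hm', ← hx]
    simp only [inn_eq_dotProduct, dotProduct_add, dotProduct_sub, dotProduct_neg]
    ring
  simp only [if_pos hpos, hneg, hx', hx, hm, hm', hνm, ne_eq, hjk, hjk.symm, not_false_eq_true,
    true_and]
  have hfac : ∀ a : ℕ, (a : ℝ) ≤ |2 * π * p / α - n * g| →
      Real.sin (α * (inn (ee n j - ee n k) (rhoP n p α g ω) +
        Real.sign (2 * π * p / α - n * g) * a) / 2) ≠ 0 := fun a ha => by
    have h := htype.sin_height_ne_zero hn hα hcop rfl (k := l - i) (by omega) (by omega)
      (Nat.cast_nonneg a) ha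
    rw [hK]
    convert sin_shift_ne_zero hα _ K h using 2
    ring
  have hfac' : ∀ a : ℕ, ((a + 1 : ℕ) : ℝ) ≤ |2 * π * p / α - n * g| →
      Real.sin (α * (inn (ee n j - ee n k) (rhoP n p α g ω) +
        Real.sign (2 * π * p / α - n * g) * (a + 1) - g) / 2) ≠ 0 := fun a ha => by
    have h : Real.sin (α * (((l - i - 1 : ℕ) : ℝ) * g +
        Real.sign (2 * π * p / α - n * g) * (a + 1 : ℕ)) / 2) ≠ 0 := by
      rcases Nat.eq_zero_or_pos (l - i - 1) with h0 | h0
      · rw [h0, Nat.cast_zero, zero_mul, zero_add]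
        exact htype.sin_sign_mul_ne_zero hn hα rfl (by positivity) ha
      · exact htype.sin_height_ne_zero hn hα hcop rfl h0 (by omega) (Nat.cast_nonneg _) ha
    have hc : ((l - i : ℕ) : ℝ) = (l - i - 1 : ℕ) + 1 := by
      exact_mod_cast (by omega : l - i = l - i - 1 + 1)
    rw [hK, hc]
    convert sin_shift_ne_zero hα _ K h using 2
    push_cast
    ring
  have hstep : ∀ a : ℕ, ((a + 1 : ℕ) : ℝ) ≤ |2 * π * p / α - n * g| → _ := fun a ha =>
    rootFactor_succ hs a (hfac a (le_trans (by push_cast; linarith) ha))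
      (by simpa using hfac (a + 1) ha) (hfac' a ha)
  unfold rootFactor at hstep
  rcases inn_root_orbit hn hν j k with h | h | h <;> rw [hνm] at h
  · obtain rfl : m' = m + 1 := by
      have : (m' : ℝ) = m + 1 := by linarith
      exact_mod_cast this
    have := hstep m hmM'
    norm_num
    norm_num at this
    exact this
  · obtain rfl : m' = m := by
      have : (m' : ℝ) = m := by linarith
      exact_mod_cast this
    norm_num
  · obtain rfl : m = m' + 1 := by
      have : (m : ℝ) = m' + 1 := by linarith
      exact_mod_cast this
    have := hstep m' hmM
    norm_num
    norm_num at this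
    exact this.symm
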